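/- The map ψ : S_2 → K_3 defined by (ef)^ℓ ↦ c^{2ℓ−1}h_1 for ℓ > 0, (ef)^m e ↦ c^{2m}h_1h_2 for m ≥ 0, (fe)^n f ↦ c^{2n}h_2h_1 for n ≥ 0, and (fe)^r ↦ c^{2r−1}h_2 for r > 0, is an injective semigroup homomorphism; hence S_2 is isomorphic to a subsemigroup of the Kauffman monoid K_3. -/

import Mathlib

open scoped Classical

/-- Generators of the Kauffman monoid `K₃`. -/
inductive K3Gen : Type
  | h1 | h2 | c
deriving DecidableEq

namespace K3Gen

/-- The defining relations of the Kauffman monoid `K₃`: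
`h₁h₂h₁ = h₁`, `h₂h₁h₂ = h₂`, `h₁² = ch₁ = h₁c`, `h₂² = ch₂ = h₂c`. -/
inductive K3Rel : FreeMonoid K3Gen → FreeMonoid K3Gen → Prop
  | braid1 : K3Rel (.of h1 * .of h2 * .of h1) (.of h1)
  | braid2 : K3Rel (.of h2 * .of h1 * .of h2) (.of h2)
  | sq1 : K3Rel (.of h1 * .of h1) (.of c * .of h1)
  | comm1 : K3Rel (.of c * .of h1) (.of h1 * .of c)
  | sq2 : K3Rel (.of h2 * .of h2) (.of c * .of h2)
  | comm2 : K3Rel (.of c * .of h2) (.of h2 * .of c)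

end K3Gen

/-- The congruence on the free monoid over the generators generated by the relations. -/
def K3Con : Con (FreeMonoid K3Gen) := conGen K3Gen.K3Rel

/-- The Kauffman monoid `K₃`. -/
def K3 : Type := K3Con.Quotient

instance : Monoid K3 := Con.monoid K3Con

namespace K3

/-- The generator `h₁` of `K₃`. -/
def h1 : K3 := K3Con.mk' (.of .h1)
/-- The generator `h₂` of `K₃`. -/
def h2 : K3 := K3Con.mk' (.of .h2)
/-- The generator `c` of `K₃`. -/
def c : K3 := K3Con.mk' (.of .c)

end K3

/-- The identity `w ≍ w'` (words over the countably infinite alphabet `ℕ`) holds in the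
monoid `M` if every monoid homomorphism from the free monoid over `ℕ` to `M` equalizes
`w` and `w'`. -/
def HoldsIn (M : Type*) [Monoid M] (w w' : List ℕ) : Prop :=
  ∀ φ : FreeMonoid ℕ →* M, φ (FreeMonoid.ofList w) = φ (FreeMonoid.ofList w')

/-- Generators of the semigroup `S₂`. -/
inductive S2Gen : Type
  | e | f

/-- The defining relations `e² = e`, `f² = f` of `S₂`. -/
inductive S2Rel : FreeSemigroup S2Gen → FreeSemigroup S2Gen → Prop
  | idem_e : S2Rel (.of .e * .of .e) (.of .e)
  | idem_f : S2Rel (.of .f * .of .f) (.of .f)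

/-- The congruence on the free semigroup generated by the relations of `S₂`. -/
def S2Con : Con (FreeSemigroup S2Gen) := conGen S2Rel

/-- The semigroup `S₂ = ⟨e, f ∣ e² = e, f² = f⟩`, the free product of two trivial
semigroups. -/
def S2 : Type := S2Con.Quotient

instance : Semigroup S2 :=
  inferInstanceAs (Semigroup S2Con.Quotient)

/-- The generator `e` of `S₂`. -/
def S2.e : S2 := (↑(FreeSemigroup.of S2Gen.e) : S2Con.Quotient)

/-- The generator `f` of `S₂`. -/
def S2.f : S2 := (↑(FreeSemigroup.of S2Gen.f) : S2Con.Quotient)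

/-- `alt a b n` is the alternating product of `n + 1` factors starting with `a`:
`alt a b 0 = a`, `alt a b 1 = ab`, `alt a b 2 = aba`, …  Thus in `S₂` the element
`(ef)^ℓ` is `alt e f (2ℓ - 1)`, `(ef)^m e` is `alt e f (2m)`, `(fe)^n f` is
`alt f e (2n)`, and `(fe)^r` is `alt f e (2r - 1)`. -/
def alt {S : Type*} [Mul S] (a b : S) : ℕ → S
  | 0 => a
  | n + 1 => alt a b n * (if n % 2 = 0 then b else a)

theorem alt_map {S T : Type*} [Mul S] [Mul T] (φ : S →ₙ* T) (a b : S) (n : ℕ) :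
    φ (alt a b n) = alt (φ a) (φ b) n := by
  induction n with
  | zero => rfl
  | succ n ih =>
    simp only [alt, map_mul, ih]
    split_ifs <;> rfl

theorem alt_same_left {S : Type*} [Semigroup S] (a b : S) (ha : a * a = a) (n : ℕ) :
    a * alt a b n = alt a b n := by
  induction n with
  | zero => exact ha
  | succ n ih => simp only [alt]; rw [← mul_assoc, ih]

theorem alt_other_left {S : Type*} [Semigroup S] (a b : S) (n : ℕ) :
    b * alt a b n = alt b a (n + 1) := by
  induction n with
  | zero => simp [alt]
  | succ n ih =>
    rw [alt, ← mul_assoc, ih, alt.eq_2 b a (n + 1)]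
    congr 1
    rcases Nat.mod_two_eq_zero_or_one n with h | h
    · have : (n + 1) % 2 = 1 := by omega
      simp [h, this]
    · have : (n + 1) % 2 = 0 := by omega
      simp [h, this]

theorem S2.ee : S2.e * S2.e = S2.e :=
  (Con.eq S2Con).2 (ConGen.Rel.of _ _ S2Rel.idem_e)

theorem S2.ff : S2.f * S2.f = S2.f :=
  (Con.eq S2Con).2 (ConGen.Rel.of _ _ S2Rel.idem_f)

theorem S2.exists_alt (x : S2) :
    ∃ n, x = alt S2.e S2.f n ∨ x = alt S2.f S2.e n := by
  induction x using Con.induction_on with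
  | H w =>
    induction w using FreeSemigroup.recOnMul with
    | ih1 g =>
      cases g
      · exact ⟨0, Or.inl rfl⟩
      · exact ⟨0, Or.inr rfl⟩
    | ih2 g w _ ih =>
      obtain ⟨n, h⟩ := ih
      cases g
      · change ∃ n, S2.e * (show S2 from (w : S2Con.Quotient)) = alt S2.e S2.f n ∨
          S2.e * (show S2 from (w : S2Con.Quotient)) = alt S2.f S2.e n
        rcases h with h | h
        · exact ⟨n, Or.inl ((congrArg (S2.e * ·) h).trans (alt_same_left _ _ S2.ee n))⟩
        · exact ⟨n + 1, Or.inl ((congrArg (S2.e * ·) h).trans (alt_other_left _ _ n))⟩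
      · change ∃ n, S2.f * (show S2 from (w : S2Con.Quotient)) = alt S2.e S2.f n ∨
          S2.f * (show S2 from (w : S2Con.Quotient)) = alt S2.f S2.e n
        rcases h with h | h
        · exact ⟨n + 1, Or.inr ((congrArg (S2.f * ·) h).trans (alt_other_left _ _ n))⟩
        · exact ⟨n, Or.inr ((congrArg (S2.f * ·) h).trans (alt_same_left _ _ S2.ff n))⟩

/-- Normal form of alternating products in a monoid satisfying the Kauffman relations. -/
theorem alt_kauffman {M : Type*} [Monoid M] (a b c : M) (hab : a * b * a = a)
    (ha : a * a = c * a) (hb : b * b = c * b)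
    (hca : c * a = a * c) (n : ℕ) :
    alt (a * b) (b * a) n = if n % 2 = 0 then c ^ n * a * b else c ^ n * a := by
  induction n with
  | zero => simp [alt]
  | succ n ih =>
    rw [alt, ih]
    rcases Nat.mod_two_eq_zero_or_one n with h | h
    · have h' : (n + 1) % 2 = 1 := by omega
      simp only [h, h', if_true, one_ne_zero, if_false]
      calc c ^ n * a * b * (b * a) = c ^ n * (a * (b * b) * a) := by simp only [mul_assoc]
        _ = c ^ n * ((a * c) * b * a) := by rw [hb]; simp only [mul_assoc]
        _ = c ^ n * (c * (a * b * a)) := by rw [← hca]; simp only [mul_assoc]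
        _ = c ^ (n + 1) * a := by rw [hab, pow_succ]; simp only [mul_assoc]
    · have h' : (n + 1) % 2 = 0 := by omega
      simp only [h, h', if_true, one_ne_zero, if_false]
      calc c ^ n * a * (a * b) = c ^ n * (a * a) * b := by simp only [mul_assoc]
        _ = c ^ (n + 1) * a * b := by rw [ha, pow_succ]; simp only [mul_assoc]

namespace K3

theorem r1 : h1 * h2 * h1 = h1 := (Con.eq K3Con).2 (ConGen.Rel.of _ _ K3Gen.K3Rel.braid1)
theorem r2 : h2 * h1 * h2 = h2 := (Con.eq K3Con).2 (ConGen.Rel.of _ _ K3Gen.K3Rel.braid2)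
theorem r3 : h1 * h1 = c * h1 := (Con.eq K3Con).2 (ConGen.Rel.of _ _ K3Gen.K3Rel.sq1)
theorem r4 : c * h1 = h1 * c := (Con.eq K3Con).2 (ConGen.Rel.of _ _ K3Gen.K3Rel.comm1)
theorem r5 : h2 * h2 = c * h2 := (Con.eq K3Con).2 (ConGen.Rel.of _ _ K3Gen.K3Rel.sq2)
theorem r6 : c * h2 = h2 * c := (Con.eq K3Con).2 (ConGen.Rel.of _ _ K3Gen.K3Rel.comm2)

/-- Images of the generators under a representation of `K₃` by `2 × 2` matrices. -/
def repGen : K3Gen → Matrix (Fin 2) (Fin 2) ℕ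
  | .h1 => !![2, 1; 0, 0]
  | .h2 => !![0, 0; 1, 2]
  | .c => !![2, 0; 0, 2]

/-- A matrix representation of `K₃`. -/
def rep : K3 →* Matrix (Fin 2) (Fin 2) ℕ :=
  Con.lift K3Con (FreeMonoid.lift repGen) (by
    refine Con.conGen_le.2 ?_
    intro x y h
    rw [Con.ker_rel]
    cases h <;> simp [repGen] <;> (ext i; fin_cases i <;> rfl))

theorem rep_h1 : rep h1 = !![2, 1; 0, 0] := rfl
theorem rep_h2 : rep h2 = !![0, 0; 1, 2] := rfl
theorem rep_c : rep c = !![2, 0; 0, 2] := rfl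

theorem rep_c_pow (n : ℕ) : rep c ^ n = !![2 ^ n, 0; 0, 2 ^ n] := by
  rw [rep_c]
  induction n with
  | zero => simp [Matrix.one_fin_two]
  | succ n ih => rw [pow_succ, ih]; simp [pow_succ]

theorem alt12 (n : ℕ) : alt (h1 * h2) (h2 * h1) n =
    if n % 2 = 0 then c ^ n * h1 * h2 else c ^ n * h1 :=
  alt_kauffman _ _ _ r1 r3 r5 r4 n

theorem alt21 (n : ℕ) : alt (h2 * h1) (h1 * h2) n =
    if n % 2 = 0 then c ^ n * h2 * h1 else c ^ n * h2 :=
  alt_kauffman _ _ _ r2 r5 r3 r6 n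

theorem inv12 (n : ℕ) : rep (alt (h1 * h2) (h2 * h1) n) 0 0 *
    rep (alt (h1 * h2) (h2 * h1) n) 0 1 = 2 ^ (2 * n + 1) := by
  rw [alt12]
  split_ifs <;> simp only [map_mul, map_pow, rep_c_pow, rep_h1, rep_h2] <;> simp <;> ring

theorem inv12' (n : ℕ) : rep (alt (h1 * h2) (h2 * h1) n) 1 0 = 0 := by
  rw [alt12]
  split_ifs <;> simp only [map_mul, map_pow, rep_c_pow, rep_h1, rep_h2] <;> simp

theorem inv21 (n : ℕ) : rep (alt (h2 * h1) (h1 * h2) n) 1 0 *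
    rep (alt (h2 * h1) (h1 * h2) n) 1 1 = 2 ^ (2 * n + 1) := by
  rw [alt21]
  split_ifs <;> simp only [map_mul, map_pow, rep_c_pow, rep_h1, rep_h2] <;> simp <;> ring

theorem ne12 (n m : ℕ) : alt (h1 * h2) (h2 * h1) n ≠ alt (h2 * h1) (h1 * h2) m := by
  intro h
  have h1 := inv12' n
  have h2 := inv21 m
  rw [← h, h1, zero_mul] at h2
  exact absurd h2.symm (by positivity)

theorem inj12 {n m : ℕ} (h : alt (h1 * h2) (h2 * h1) n = alt (h1 * h2) (h2 * h1) m) :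
    n = m := by
  have h2 := inv12 n
  rw [h, inv12] at h2
  have := Nat.pow_right_injective le_rfl h2
  omega

theorem inj21 {n m : ℕ} (h : alt (h2 * h1) (h1 * h2) n = alt (h2 * h1) (h1 * h2) m) :
    n = m := by
  have h2 := inv21 n
  rw [h, inv21] at h2
  have := Nat.pow_right_injective le_rfl h2
  omega

end K3

/-- Images of the generators of `S₂` in `K₃`. -/
def psiGen : S2Gen → K3
  | .e => K3.h1 * K3.h2
  | .f => K3.h2 * K3.h1

/-- The extension to the free semigroup. -/
def psiFree : FreeSemigroup S2Gen →ₙ* K3 := FreeSemigroup.lift psiGen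

theorem psiFree_le : ∀ x y, S2Con x y → psiFree x = psiFree y := by
  intro x y h
  change ConGen.Rel S2Rel x y at h
  induction h with
  | of x y h =>
    cases h
    · change K3.h1 * K3.h2 * (K3.h1 * K3.h2) = K3.h1 * K3.h2
      rw [← mul_assoc, K3.r1]
    · change K3.h2 * K3.h1 * (K3.h2 * K3.h1) = K3.h2 * K3.h1
      rw [← mul_assoc, K3.r2]
  | refl x => rfl
  | symm _ ih => exact ih.symm
  | trans _ _ ih1 ih2 => exact ih1.trans ih2
  | mul _ _ ih1 ih2 => rw [map_mul, map_mul, ih1, ih2]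

/-- The embedding of `S₂` into `K₃`. -/
def psi : S2 →ₙ* K3 where
  toFun x := Quotient.liftOn x psiFree psiFree_le
  map_mul' x y := by
    induction x using Con.induction_on with
    | H x =>
      induction y using Con.induction_on with
      | H y => exact map_mul psiFree x y

theorem psi_ef (n : ℕ) : psi (alt S2.e S2.f n) =
    alt (K3.h1 * K3.h2) (K3.h2 * K3.h1) n := alt_map psi _ _ n

theorem psi_fe (n : ℕ) : psi (alt S2.f S2.e n) =
    alt (K3.h2 * K3.h1) (K3.h1 * K3.h2) n := alt_map psi _ _ n

/-- The map `ψ : S₂ → K₃` given by `(ef)^ℓ ↦ c^{2ℓ-1}h₁` (`ℓ > 0`),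
`(ef)^m e ↦ c^{2m}h₁h₂` (`m ≥ 0`), `(fe)^n f ↦ c^{2n}h₂h₁` (`n ≥ 0`) and
`(fe)^r ↦ c^{2r-1}h₂` (`r > 0`) is an injective semigroup homomorphism; hence `S₂` is
isomorphic to a subsemigroup of the Kauffman monoid `K₃`. -/
theorem S2_embeds_in_K3 :
    ∃ ψ : S2 →ₙ* K3,
      Function.Injective ψ ∧
      (∀ l : ℕ, 0 < l → ψ (alt S2.e S2.f (2 * l - 1)) = K3.c ^ (2 * l - 1) * K3.h1) ∧
      (∀ m : ℕ, ψ (alt S2.e S2.f (2 * m)) = K3.c ^ (2 * m) * K3.h1 * K3.h2) ∧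
      (∀ n : ℕ, ψ (alt S2.f S2.e (2 * n)) = K3.c ^ (2 * n) * K3.h2 * K3.h1) ∧
      (∀ r : ℕ, 0 < r → ψ (alt S2.f S2.e (2 * r - 1)) = K3.c ^ (2 * r - 1) * K3.h2) := by
  refine ⟨psi, ?_, ?_, ?_, ?_, ?_⟩
  · intro x y h
    obtain ⟨n, rfl | rfl⟩ := S2.exists_alt x <;> obtain ⟨m, rfl | rfl⟩ := S2.exists_alt y <;>
      simp only [psi_ef, psi_fe] at h
    · rw [K3.inj12 h]
    · exact absurd h (K3.ne12 _ _)
    · exact absurd h.symm (K3.ne12 _ _)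
    · rw [K3.inj21 h]
  · intro l hl
    rw [psi_ef, K3.alt12, if_neg (by omega)]
  · intro m
    rw [psi_ef, K3.alt12, if_pos (by omega)]
  · intro m
    rw [psi_fe, K3.alt21, if_pos (by omega)]
  · intro l hl
    rw [psi_fe, K3.alt21, if_neg (by omega)]
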